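/- Let g be a symmetric bilinear form on V (dim V = n ≥ 2) and W ⊂ V a linear hyperplane such that the restriction of g to W × W is negative semi-definite with radical of dimension at most 1. If there exists w ∈ V ∖ W with g(w,w) > 0 and g(w,v) ≠ 0 for every nonzero vector v in the radical of g restricted to W, then g is nondegenerate with index n−1. -/

import Mathlib

open Set Module

noncomputable section

variable {V : Type*} [AddCommGroup V] [Module ℝ V]

/-- Lorentzian: nondegenerate and negative definite on a subspace of dimension `n-1`. -/
def IsLorentzForm (g : V → V → ℝ) : Prop :=
  (∀ u : V, (∀ w : V, g u w = 0) → u = 0) ∧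
  ∃ W : Submodule ℝ V, finrank ℝ W = finrank ℝ V - 1 ∧
    ∀ u ∈ W, u ≠ 0 → g u u < 0

/-- The radical of the restriction of `g` to the subspace `W`. -/
def radicalOn (g : V →ₗ[ℝ] V →ₗ[ℝ] ℝ) (W : Submodule ℝ V) : Submodule ℝ V :=
  W ⊓ ⨅ w ∈ W, LinearMap.ker (g.flip w)

/-- Cauchy-Schwarz, degenerate case: a null vector of a negative semi-definite form on `W` is
orthogonal to `W`. -/
lemma apply_eq_zero_of_nonpos_of_apply_self_eq_zero (g : V →ₗ[ℝ] V →ₗ[ℝ] ℝ)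
    (hsym : ∀ u w : V, g u w = g w u) (W : Submodule ℝ V) (hneg : ∀ u ∈ W, g u u ≤ 0)
    {x y : V} (hx : x ∈ W) (hy : y ∈ W) (hxx : g x x = 0) : g x y = 0 := by
  by_contra h
  have key := hneg _ (W.add_mem hy (W.smul_mem ((1 - g y y) / (2 * g x y)) hx))
  simp only [map_add, map_smul, LinearMap.add_apply, LinearMap.smul_apply, smul_eq_mul, hxx,
    hsym y x] at key
  have ht : (1 - g y y) / (2 * g x y) * g x y = (1 - g y y) / 2 := by
    field_simp
  linarith

/-- A hyperplane and a vector outside it span the whole space. -/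
lemma exists_eq_smul_add_of_notMem_hyperplane [FiniteDimensional ℝ V] (W : Submodule ℝ V)
    (hW : finrank ℝ W = finrank ℝ V - 1) {w : V} (hw : w ∉ W) (u : V) :
    ∃ a : ℝ, ∃ x ∈ W, u = a • w + x := by
  have hlt : W < Submodule.span ℝ {w} ⊔ W :=
    lt_of_le_of_ne le_sup_right fun h =>
      hw (h ▸ Submodule.mem_sup_left (Submodule.mem_span_singleton_self w))
  have htop : Submodule.span ℝ {w} ⊔ W = ⊤ := by
    apply Submodule.eq_top_of_finrank_eq
    have h₁ := Submodule.finrank_lt_finrank_of_lt hlt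
    have h₂ := Submodule.finrank_le (Submodule.span ℝ {w} ⊔ W)
    omega
  have hu : u ∈ Submodule.span ℝ {w} ⊔ W := htop ▸ Submodule.mem_top
  obtain ⟨y, hy, x, hx, rfl⟩ := Submodule.mem_sup.mp hu
  obtain ⟨a, rfl⟩ := Submodule.mem_span_singleton.mp hy
  exact ⟨a, x, hx, rfl⟩

/-- a symmetric bilinear form which is negative semi-definite on a
hyperplane with radical of dimension at most one, and positive on some vector
not orthogonal to the radical, is Lorentzian. -/
theorem stmt_11 [FiniteDimensional ℝ V] (hn : 2 ≤ finrank ℝ V)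
    (g : V →ₗ[ℝ] V →ₗ[ℝ] ℝ) (hsym : ∀ u w : V, g u w = g w u)
    (W : Submodule ℝ V) (hW : finrank ℝ W = finrank ℝ V - 1)
    (hneg : ∀ u ∈ W, g u u ≤ 0)
    (hrad : finrank ℝ (radicalOn g W) ≤ 1)
    (w : V) (hwW : w ∉ W) (hww : 0 < g w w)
    (hwrad : ∀ v ∈ radicalOn g W, v ≠ 0 → g w v ≠ 0) :
    IsLorentzForm (fun u u' => g u u') := by
  have hdef : ∀ u ∈ LinearMap.ker (g w), u ≠ 0 → g u u < 0 := by
    intro u hu hu0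
    rw [LinearMap.mem_ker] at hu
    obtain ⟨a, x, hx, rfl⟩ := exists_eq_smul_add_of_notMem_hyperplane W hW hwW u
    have hxx := hneg x hx
    simp only [map_add, map_smul, smul_eq_mul] at hu
    have hself : g (a • w + x) (a • w + x) = -(a ^ 2 * g w w) + g x x := by
      simp only [map_add, map_smul, LinearMap.add_apply, LinearMap.smul_apply, smul_eq_mul,
        hsym x w]
      linear_combination 2 * a * hu
    rw [hself]
    rcases eq_or_ne a 0 with rfl | ha
    · simp only [zero_smul, zero_add, zero_mul] at hu hu0
      have hne : g x x ≠ 0 := by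
        intro h
        refine hwrad x ?_ hu0 hu
        simp only [radicalOn, Submodule.mem_inf, Submodule.mem_iInf, LinearMap.mem_ker,
          LinearMap.flip_apply]
        exact ⟨hx, fun y hy =>
          apply_eq_zero_of_nonpos_of_apply_self_eq_zero g hsym W hneg hx hy h⟩
      have := lt_of_le_of_ne hxx hne
      linarith
    · have : 0 < a ^ 2 * g w w := by positivity
      linarith
  refine ⟨fun u hu => ?_, LinearMap.ker (g w), ?_, hdef⟩
  · by_contra hu0
    exact (hdef u (by rw [LinearMap.mem_ker, hsym]; exact hu w) hu0).ne (hu u)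
  · have hgw : g w ≠ 0 := fun h => by simp [h] at hww
    have := Module.Dual.finrank_ker_add_one_of_ne_zero hgw
    omega
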